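/- arXiv:1510.07925 — 6 statements merged into one kernel-verified Lean document; each statement's English description precedes it below -/
import Mathlib

section
/- If ‖a‖₁ > b, then the unique minimizer (x*, y*) of the ℓ1-cone projection problem satisfies ‖x*‖₁ = y* (the constraint is active) and a_i · x*_i ≥ 0 for every coordinate i (each nonzero entry of x* has the same sign as the corresponding entry of a). -/
/-- If `‖a‖₁ > b`, the unique minimizer `(x*, y*)` of the ℓ1-cone projection problem
satisfies `‖x*‖₁ = y*` (constraint active) and `a_i · x*_i ≥ 0` for every coordinate. -/
theorem stmt_3 (d : ℕ) (ζ : ℝ) (hζ : 0 < ζ) (a : Fin d → ℝ) (b : ℝ)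
    (h : b < ∑ i, |a i|)
    (x : Fin d → ℝ) (y : ℝ) (hfeas : ∑ i, |x i| ≤ y)
    (hmin : ∀ (x' : Fin d → ℝ) (y' : ℝ), ∑ i, |x' i| ≤ y' →
      (1 / 2) * ∑ i, (x i - a i) ^ 2 + (ζ / 2) * (y - b) ^ 2 ≤
        (1 / 2) * ∑ i, (x' i - a i) ^ 2 + (ζ / 2) * (y' - b) ^ 2) :
    (∑ i, |x i|) = y ∧ ∀ i, 0 ≤ a i * x i := by
  constructor
  · by_contra hne
    have hlt : ∑ i, |x i| < y := lt_of_le_of_ne hfeas hne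
    set S := ∑ i, |x i| with hS
    set A := ∑ i, |a i| with hA
    have hD : 0 < (y - S) + (A - b) := by linarith
    obtain ⟨t, ht⟩ : ∃ t, t = (y - S) / ((y - S) + (A - b)) := ⟨_, rfl⟩
    have ht0 : 0 < t := by rw [ht]; exact div_pos (by linarith) hD
    have ht1 : t < 1 := by rw [ht, div_lt_one hD]; linarith
    have hte : t * ((y - S) + (A - b)) = y - S := by
      rw [ht]; exact div_mul_cancel₀ _ hD.ne'
    have hf : ∑ i, |x i + t * (a i - x i)| ≤ y + t * (b - y) := by
      have h1 : ∑ i, |x i + t * (a i - x i)| ≤ ∑ i, ((1 - t) * |x i| + t * |a i|) := by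
        apply Finset.sum_le_sum
        intro i _
        have e : x i + t * (a i - x i) = (1 - t) * x i + t * a i := by ring
        rw [e]
        refine (abs_add_le _ _).trans ?_
        rw [abs_mul, abs_mul, abs_of_pos ht0, abs_of_pos (by linarith : 0 < 1 - t)]
      rw [Finset.sum_add_distrib, ← Finset.mul_sum, ← Finset.mul_sum, ← hS, ← hA] at h1
      nlinarith
    have hm := hmin _ _ hf
    have e : ∑ i, (x i + t * (a i - x i) - a i) ^ 2 = (1 - t) ^ 2 * ∑ i, (x i - a i) ^ 2 := by
      rw [Finset.mul_sum]
      exact Finset.sum_congr rfl fun i _ => by ring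
    rw [e] at hm
    have hQ : 0 ≤ ∑ i, (x i - a i) ^ 2 := Finset.sum_nonneg fun i _ => sq_nonneg _
    have hR : 0 ≤ ζ * (y - b) ^ 2 := by positivity
    have hk : 0 < 1 - (1 - t) ^ 2 := by nlinarith
    have hz : (∑ i, (x i - a i) ^ 2) + ζ * (y - b) ^ 2 ≤ 0 := by
      by_contra hc
      push Not at hc
      have := mul_pos hk hc
      nlinarith
    have hQ0 : ∑ i, (x i - a i) ^ 2 = 0 := by linarith
    have hR0 : ζ * (y - b) ^ 2 = 0 := by linarith
    have hy : y - b = 0 := by simpa [hζ.ne'] using hR0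
    have hx : S = A := by
      rw [hS, hA]
      refine Finset.sum_congr rfl fun i hi => ?_
      have h2 := (Finset.sum_eq_zero_iff_of_nonneg (fun i _ => sq_nonneg (x i - a i))).1 hQ0 i hi
      have h3 : x i - a i = 0 := by simpa using h2
      rw [sub_eq_zero.1 h3]
    linarith
  · intro i
    by_contra hneg
    push Not at hneg
    have hm := hmin (fun j => if j = i then -x j else x j) y (by
      refine le_trans (le_of_eq ?_) hfeas
      refine Finset.sum_congr rfl fun j _ => ?_
      split_ifs <;> simp)
    have hs : ∑ j, ((if j = i then -x j else x j) - a j) ^ 2 < ∑ j, (x j - a j) ^ 2 := by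
      refine Finset.sum_lt_sum (fun j _ => ?_) ⟨i, Finset.mem_univ i, ?_⟩
      · split_ifs with hj
        · subst hj; nlinarith
        · exact le_rfl
      · rw [if_pos rfl]; nlinarith
    linarith
end

section
/- Let (x*, y*) be the unique minimizer of the ℓ1-cone projection problem for data a ∈ ℝ^d, b ∈ ℝ, ζ > 0. Then the optimal solution is monotone with respect to the data: for any indices i, j, if |a_i| ≥ |a_j| then |x*_i| ≥ |x*_j|. -/
/-- The unique minimizer `(x*, y*)` of the ℓ1-cone projection problem is monotone with
respect to the data: if `|a_i| ≥ |a_j|` then `|x*_i| ≥ |x*_j|`. -/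
theorem stmt_4 (d : ℕ) (ζ : ℝ) (hζ : 0 < ζ) (a : Fin d → ℝ) (b : ℝ)
    (x : Fin d → ℝ) (y : ℝ) (hfeas : ∑ i, |x i| ≤ y)
    (hmin : ∀ (x' : Fin d → ℝ) (y' : ℝ), ∑ i, |x' i| ≤ y' →
      (1 / 2) * ∑ i, (x i - a i) ^ 2 + (ζ / 2) * (y - b) ^ 2 ≤
        (1 / 2) * ∑ i, (x' i - a i) ^ 2 + (ζ / 2) * (y' - b) ^ 2) :
    ∀ i j : Fin d, |a j| ≤ |a i| → |x j| ≤ |x i| := by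
  intro i j hA
  by_contra hlt
  push Not at hlt
  have hij : i ≠ j := by
    rintro rfl
    exact lt_irrefl _ hlt
  have hs : ∀ r : ℝ, ∃ s : ℝ, |s| = 1 ∧ s ^ 2 = 1 ∧ s * r = |r| := by
    intro r
    rcases le_total 0 r with h | h
    · exact ⟨1, by simp, by simp, by simp [abs_of_nonneg h]⟩
    · exact ⟨-1, by simp, by simp, by simp [abs_of_nonpos h]⟩
  obtain ⟨s, hs1, hs2, hs3⟩ := hs (a i)
  obtain ⟨t, ht1, ht2, ht3⟩ := hs (a j)
  obtain ⟨m, hm⟩ : ∃ m, m = (|x i| + |x j|) / 2 := ⟨_, rfl⟩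
  have hm0 : 0 ≤ m := by rw [hm]; positivity
  obtain ⟨x', hi, hj, hk⟩ : ∃ x' : Fin d → ℝ, x' i = s * m ∧ x' j = t * m ∧
      ∀ k, k ≠ i ∧ k ≠ j → x' k = x k :=
    ⟨fun k => if k = i then s * m else if k = j then t * m else x k,
      by simp, by simp [hij.symm], fun k h => by simp [h.1, h.2]⟩
  have e1 : ∑ k, (|x' k| - |x k|) = (|x' i| - |x i|) + (|x' j| - |x j|) :=
    Fintype.sum_eq_add i j hij (fun k h => by rw [hk k h, sub_self])
  have e2 : ∑ k, ((x' k - a k) ^ 2 - (x k - a k) ^ 2) =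
      ((x' i - a i) ^ 2 - (x i - a i) ^ 2) + ((x' j - a j) ^ 2 - (x j - a j) ^ 2) :=
    Fintype.sum_eq_add i j hij (fun k h => by rw [hk k h, sub_self])
  rw [Finset.sum_sub_distrib, hi, hj] at e1 e2
  rw [abs_mul, abs_mul, hs1, ht1, abs_of_nonneg hm0] at e1
  have h := hmin x' y (by linarith)
  have f1 : (s * m - a i) ^ 2 = m ^ 2 - 2 * m * |a i| + a i ^ 2 := by
    rw [← hs3]; linear_combination m ^ 2 * hs2
  have f2 : (t * m - a j) ^ 2 = m ^ 2 - 2 * m * |a j| + a j ^ 2 := by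
    rw [← ht3]; linear_combination m ^ 2 * ht2
  have g : ∀ u v : ℝ, |u| ^ 2 - 2 * (|u| * |v|) + v ^ 2 ≤ (u - v) ^ 2 := by
    intro u v
    have := le_abs_self (u * v)
    rw [abs_mul] at this
    rw [sq_abs]
    nlinarith
  have g1 := g (x i) (a i)
  have g2 := g (x j) (a j)
  have q1 : 0 < (|x j| - |x i|) ^ 2 := by
    have : 0 < |x j| - |x i| := by linarith
    positivity
  have q2 : 0 ≤ (|x j| - |x i|) * (|a i| - |a j|) :=
    mul_nonneg (by linarith) (by linarith)
  rw [f1, f2] at e2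
  subst hm
  nlinarith
end

section
/- For any fixed y ≥ 0, the minimum of (1/2)‖x − a‖² over x ∈ ℝ^d with ‖x‖_∞ ≤ y is attained uniquely at x_i = sgn(a_i)·min(|a_i|, y) for each i, and its value is (1/2) Σ_{i=1}^d min(y − |a_i|, 0)². Consequently, the ℓ∞-cone projection problem is equivalent to the one-dimensional problem min over y ≥ 0 of (ζ/2)(y − b)² + (1/2) Σ_{i=1}^d min(y − |a_i|, 0)², in the sense that (x*, y*) solves the former if and only if y* solves the latter and x*_i = sgn(a_i)·min(|a_i|, y*). -/
theorem aux_abs (a y : ℝ) (hy : 0 ≤ y) : |Real.sign a * min (|a|) y| ≤ y := by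
  rcases lt_trichotomy a 0 with h | h | h
  · rw [Real.sign_of_neg h, neg_one_mul, abs_neg, abs_of_nonneg (le_min (abs_nonneg a) hy)]
    exact min_le_right _ _
  · subst h; simpa using hy
  · rw [Real.sign_of_pos h, one_mul, abs_of_nonneg (le_min (abs_nonneg a) hy)]
    exact min_le_right _ _

theorem aux_val (a y : ℝ) (hy : 0 ≤ y) :
    (Real.sign a * min (|a|) y - a) ^ 2 = (min (y - |a|) 0) ^ 2 := by
  rcases lt_trichotomy a 0 with h | h | h
  · rw [Real.sign_of_neg h, abs_of_neg h]
    rcases le_total (-a) y with h1 | h1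
    · rw [min_eq_left h1, min_eq_right (by linarith)]; ring
    · rw [min_eq_right h1, min_eq_left (by linarith)]; ring
  · subst h; simp [hy]
  · rw [Real.sign_of_pos h, abs_of_pos h]
    rcases le_total a y with h1 | h1
    · rw [min_eq_left h1, min_eq_right (by linarith)]; ring
    · rw [min_eq_right h1, min_eq_left (by linarith)]; ring

theorem aux_pt (a y x : ℝ) (hx : |x| ≤ y) :
    (Real.sign a * min (|a|) y - a) ^ 2 + (x - Real.sign a * min (|a|) y) ^ 2
      ≤ (x - a) ^ 2 := by
  obtain ⟨hx1, hx2⟩ := abs_le.1 hx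
  rcases lt_trichotomy a 0 with h | h | h
  · rw [Real.sign_of_neg h, abs_of_neg h]
    rcases le_total (-a) y with h1 | h1
    · rw [min_eq_left h1]; apply le_of_eq; ring
    · rw [min_eq_right h1]
      nlinarith [mul_nonneg (by linarith : 0 ≤ x + y) (by linarith : 0 ≤ -a - y)]
  · subst h; simp
  · rw [Real.sign_of_pos h, abs_of_pos h]
    rcases le_total a y with h1 | h1
    · rw [min_eq_left h1]; apply le_of_eq; ring
    · rw [min_eq_right h1]
      nlinarith [mul_nonneg (by linarith : 0 ≤ y - x) (by linarith : 0 ≤ a - y)]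

theorem aux_sup {d : ℕ} (x : Fin d → ℝ) (y : ℝ) (h : (⨆ i, |x i|) ≤ y) (i : Fin d) :
    |x i| ≤ y :=
  (le_ciSup (f := fun i => |x i|) (Set.finite_range _).bddAbove i).trans h

theorem aux_sup0 {d : ℕ} (x : Fin d → ℝ) (y : ℝ) (h : (⨆ i, |x i|) ≤ y) : 0 ≤ y :=
  (Real.iSup_nonneg fun i => abs_nonneg (x i)).trans h

theorem aux_sum {d : ℕ} (a x : Fin d → ℝ) (y : ℝ) (h : (⨆ i, |x i|) ≤ y) :
    ∑ i, (Real.sign (a i) * min (|a i|) y - a i) ^ 2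
      + ∑ i, (x i - Real.sign (a i) * min (|a i|) y) ^ 2 ≤ ∑ i, (x i - a i) ^ 2 := by
  rw [← Finset.sum_add_distrib]
  exact Finset.sum_le_sum fun i _ => aux_pt _ _ _ (aux_sup x y h i)

theorem aux_uniq {d : ℕ} (a x : Fin d → ℝ) (y : ℝ) (h : (⨆ i, |x i|) ≤ y)
    (hle : ∑ i, (x i - a i) ^ 2 ≤ ∑ i, (Real.sign (a i) * min (|a i|) y - a i) ^ 2)
    (i : Fin d) : x i = Real.sign (a i) * min (|a i|) y := by
  have h1 := aux_sum a x y h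
  have h2 := Finset.single_le_sum
    (f := fun i => (x i - Real.sign (a i) * min (|a i|) y) ^ 2)
    (fun j _ => sq_nonneg _) (Finset.mem_univ i)
  have h3 : (x i - Real.sign (a i) * min (|a i|) y) ^ 2 ≤ 0 := by
    linarith
  have h4 := pow_eq_zero_iff (two_ne_zero) |>.1 (le_antisymm h3 (sq_nonneg _))
  linarith

theorem aux_min {d : ℕ} (a x : Fin d → ℝ) (y : ℝ) (h : (⨆ i, |x i|) ≤ y) :
    ∑ i, (Real.sign (a i) * min (|a i|) y - a i) ^ 2 ≤ ∑ i, (x i - a i) ^ 2 := by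
  have h1 := aux_sum a x y h
  have h2 : 0 ≤ ∑ i, (x i - Real.sign (a i) * min (|a i|) y) ^ 2 :=
    Finset.sum_nonneg fun i _ => sq_nonneg _
  linarith

/-- For fixed `y ≥ 0`, the minimum of `(1/2)‖x − a‖²` over `‖x‖_∞ ≤ y` is attained
uniquely at `x_i = sgn(a_i)·min(|a_i|, y)` with value `(1/2) Σ_i min(y − |a_i|, 0)²`.
Consequently the ℓ∞-cone projection problem is equivalent to the one-dimensional
problem `min_{y ≥ 0} (ζ/2)(y − b)² + (1/2) Σ_i min(y − |a_i|, 0)²`. -/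
theorem stmt_8 (d : ℕ) (ζ : ℝ) (hζ : 0 < ζ) (a : Fin d → ℝ) (b : ℝ) :
    (∀ y : ℝ, 0 ≤ y →
      ((⨆ i, |Real.sign (a i) * min (|a i|) y|) ≤ y) ∧
      (∀ x : Fin d → ℝ, (⨆ i, |x i|) ≤ y →
        (1 / 2) * ∑ i, (Real.sign (a i) * min (|a i|) y - a i) ^ 2 ≤
          (1 / 2) * ∑ i, (x i - a i) ^ 2) ∧
      (∀ x : Fin d → ℝ, (⨆ i, |x i|) ≤ y →
        (1 / 2) * ∑ i, (x i - a i) ^ 2 =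
          (1 / 2) * ∑ i, (Real.sign (a i) * min (|a i|) y - a i) ^ 2 →
        x = fun i => Real.sign (a i) * min (|a i|) y) ∧
      ((1 / 2) * ∑ i, (Real.sign (a i) * min (|a i|) y - a i) ^ 2 =
        (1 / 2) * ∑ i, (min (y - |a i|) 0) ^ 2)) ∧
    (∀ (xs : Fin d → ℝ) (ys : ℝ),
      ((⨆ i, |xs i|) ≤ ys ∧
        ∀ (x : Fin d → ℝ) (y : ℝ), (⨆ i, |x i|) ≤ y →
          (1 / 2) * ∑ i, (xs i - a i) ^ 2 + (ζ / 2) * (ys - b) ^ 2 ≤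
            (1 / 2) * ∑ i, (x i - a i) ^ 2 + (ζ / 2) * (y - b) ^ 2) ↔
      (0 ≤ ys ∧
        (∀ y : ℝ, 0 ≤ y →
          (ζ / 2) * (ys - b) ^ 2 + (1 / 2) * ∑ i, (min (ys - |a i|) 0) ^ 2 ≤
            (ζ / 2) * (y - b) ^ 2 + (1 / 2) * ∑ i, (min (y - |a i|) 0) ^ 2) ∧
        ∀ i, xs i = Real.sign (a i) * min (|a i|) ys)) := by
  have hfeas : ∀ y : ℝ, 0 ≤ y → (⨆ i, |Real.sign (a i) * min (|a i|) y|) ≤ y :=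
    fun y hy => Real.iSup_le (fun i => aux_abs _ _ hy) hy
  have hval : ∀ y : ℝ, 0 ≤ y → ∑ i, (Real.sign (a i) * min (|a i|) y - a i) ^ 2 =
      ∑ i, (min (y - |a i|) 0) ^ 2 :=
    fun y hy => Finset.sum_congr rfl fun i _ => aux_val _ _ hy
  refine ⟨fun y hy => ⟨hfeas y hy, fun x hx => ?_, fun x hx he => ?_, ?_⟩, fun xs ys => ?_⟩
  · linarith [aux_min a x y hx]
  · funext i
    exact aux_uniq a x y hx (by linarith) i
  · rw [hval y hy]
  · constructor
    · rintro ⟨hf, hm⟩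
      have hy := aux_sup0 xs ys hf
      refine ⟨hy, fun y hy' => ?_, fun i => aux_uniq a xs ys hf ?_ i⟩
      · have h1 := hm _ y (hfeas y hy')
        have h2 := aux_min a xs ys hf
        rw [hval y hy'] at h1
        rw [hval ys hy] at h2
        linarith
      · have h1 := hm _ ys (hfeas ys hy)
        linarith
    · rintro ⟨hy, hm, hx⟩
      obtain rfl : xs = fun i => Real.sign (a i) * min (|a i|) ys := funext hx
      refine ⟨hfeas ys hy, fun x y hxy => ?_⟩
      have hy' := aux_sup0 x y hxy
      have h1 := hm y hy'
      have h2 := aux_min a x y hxy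
      rw [hval y hy'] at h2
      have h3 := hval ys hy
      simp only
      linarith
end

section
/- Let t ∈ (0,1), let m divide n with group size n/m, and assume s(1 + 0.1t) ≤ n. In the uniform random grouping model with a fixed set Ω of s true indices, the probability (over the random partition) that (1 − t)·max_{j∈{1,…,m}} |Ω_j| ≥ (1 + t)·min_{j∈{1,…,m}} |Ω_j| (i.e., that the ratio max_j|Ω_j| / min_j|Ω_j| exceeds (1+t)/(1−t)) is at most 3·exp(−0.08 t² s/m + log m) + exp(−0.001 t² s). -/
open scoped Classical


/-- Balanced labellings. -/
noncomputable def balA (n m : ℕ) : Finset (Fin n → Fin m) :=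
  Finset.univ.filter fun π : Fin n → Fin m =>
          ∀ j : Fin m, (Finset.univ.filter fun i => π i = j).card = n / m

lemma balA_swap {n m : ℕ} (σ : Equiv.Perm (Fin n)) {π : Fin n → Fin m} (h : π ∈ balA n m) :
    π ∘ σ ∈ balA n m := by
  simp only [balA, Finset.mem_filter, Finset.mem_univ, true_and] at h ⊢
  intro j
  rw [← h j]
  apply Finset.card_bij (fun i _ => σ i)
  · intro a ha; simpa using ha
  · intro a _ b _ hab; exact σ.injective hab
  · intro b hb; exact ⟨σ.symm b, by simpa using hb, by simp⟩

noncomputable def NN (n m : ℕ) (J : Finset (Fin m)) (S : Finset (Fin n)) : Finset (Fin n → Fin m) :=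
  (balA n m).filter fun π => ∀ i ∈ S, π i ∈ J

lemma NN_sym {n m : ℕ} (J : Finset (Fin m)) (S : Finset (Fin n)) (a b : Fin n)
    (ha : a ∉ S) (hb : b ∉ S) : (NN n m J (insert a S)).card ≤ (NN n m J (insert b S)).card := by
  apply Finset.card_le_card_of_injOn (fun π => π ∘ (Equiv.swap a b))
  · intro π hπ
    simp only [NN, Finset.coe_filter, Set.mem_ofPred_eq, Finset.forall_mem_insert] at hπ ⊢
    refine ⟨balA_swap _ hπ.1, ?_, ?_⟩
    · simpa using hπ.2.1
    · intro i hi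
      have h1 : i ≠ a := fun h => ha (h ▸ hi)
      have h2 : i ≠ b := fun h => hb (h ▸ hi)
      simpa [Equiv.swap_apply_of_ne_of_ne h1 h2] using hπ.2.2 i hi
  · intro π _ ρ _ h
    exact (Equiv.swap a b).surjective.injective_comp_right h

lemma bal_cardJ {n m : ℕ} (J : Finset (Fin m)) {π : Fin n → Fin m} (h : π ∈ balA n m) :
    (Finset.univ.filter fun i => π i ∈ J).card = J.card * (n / m) := by
  simp only [balA, Finset.mem_filter, Finset.mem_univ, true_and] at h
  rw [Finset.card_eq_sum_card_fiberwise (f := π) (t := J)]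
  · rw [Finset.sum_congr rfl (g := fun _ => n / m)]
    · simp
    · intro j hj
      rw [← h j, Finset.filter_filter]
      congr 1
      ext i
      simp only [Finset.mem_filter, Finset.mem_univ, true_and]
      constructor
      · exact fun h => h.2
      · rintro rfl; exact ⟨hj, rfl⟩
  · intro i hi; simpa using hi

lemma NN_insert {n m : ℕ} (J : Finset (Fin m)) (S : Finset (Fin n)) (a : Fin n) (ha : a ∉ S) :
    ((n : ℝ) - S.card) * (NN n m J (insert a S)).card
      = (((J.card * (n / m) : ℕ) : ℝ) - S.card) * (NN n m J S).card := by
  have h1 : ∑ b ∈ Sᶜ, ((NN n m J (insert b S)).card : ℝ)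
      = ((n : ℝ) - S.card) * (NN n m J (insert a S)).card := by
    rw [Finset.sum_congr rfl (g := fun _ => ((NN n m J (insert a S)).card : ℝ))]
    · rw [Finset.sum_const, Finset.card_compl, nsmul_eq_mul, Nat.cast_sub (Finset.card_le_univ S)]
      simp
    · intro b hb
      rw [Finset.mem_compl] at hb
      exact_mod_cast le_antisymm (NN_sym J S b a hb ha) (NN_sym J S a b ha hb)
  rw [← h1]
  have h2 : ∀ b ∈ Sᶜ, ((NN n m J (insert b S)).card : ℝ)
      = ∑ π ∈ NN n m J S, if π b ∈ J then (1 : ℝ) else 0 := by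
    intro b _
    rw [Finset.sum_boole]
    congr 2
    ext π
    simp only [NN, Finset.mem_filter, Finset.forall_mem_insert]
    tauto
  rw [Finset.sum_congr rfl h2, Finset.sum_comm]
  rw [Finset.sum_congr rfl (g := fun _ => ((J.card * (n / m) : ℕ) : ℝ) - S.card)]
  · rw [Finset.sum_const, nsmul_eq_mul, mul_comm]
  · intro π hπ
    simp only [NN, Finset.mem_filter] at hπ
    have h3 := bal_cardJ J hπ.1
    have h4 : ∑ b, (if π b ∈ J then (1 : ℝ) else 0) = ((J.card * (n / m) : ℕ) : ℝ) := by
      rw [Finset.sum_boole, h3]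
    have h5 : ∑ b ∈ S, (if π b ∈ J then (1 : ℝ) else 0) = S.card := by
      rw [Finset.sum_congr rfl (g := fun _ => (1 : ℝ))]
      · simp
      · intro i hi; simp [hπ.2 i hi]
    have h6 := Finset.sum_add_sum_compl S (fun b => if π b ∈ J then (1 : ℝ) else 0)
    linarith

lemma NN_bound {n m : ℕ} (hm : 0 < m) (hmn : m ∣ n) (J : Finset (Fin m)) (S : Finset (Fin n)) :
    ((NN n m J S).card : ℝ) ≤ ((J.card : ℝ) / m) ^ S.card * (balA n m).card := by
  induction S using Finset.induction_on with
  | empty => simp [NN]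
  | insert a S ha ih =>
    have h := NN_insert J S a ha
    have hmR : (0 : ℝ) < m := by exact_mod_cast hm
    set p : ℝ := (J.card : ℝ) / m with hp
    have hp0 : 0 ≤ p := by positivity
    have hp1 : p ≤ 1 := by
      rw [hp, div_le_one hmR]
      have := Finset.card_le_univ J
      simp at this
      exact_mod_cast this
    have hK : ((J.card * (n / m) : ℕ) : ℝ) = p * n := by
      rw [hp, Nat.cast_mul, Nat.cast_div hmn hmR.ne']; ring
    rw [hK] at h
    have hc : ((S.card : ℝ)) < n := by
      have := Finset.card_lt_univ_of_notMem ha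
      simp at this
      exact_mod_cast this
    have h7 : ((NN n m J (insert a S)).card : ℝ) ≤ p * (NN n m J S).card := by
      have hpos : 0 < (n : ℝ) - S.card := by linarith
      rw [← mul_le_mul_iff_right₀ hpos, h]
      have : 0 ≤ ((NN n m J S).card : ℝ) * (S.card * (1 - p)) :=
        mul_nonneg (by positivity) (mul_nonneg (by positivity) (by linarith))
      nlinarith
    rw [Finset.card_insert_of_notMem ha, pow_succ]
    calc _ ≤ _ := h7
      _ ≤ p * (p ^ S.card * (balA n m).card) := by gcongr
      _ = _ := by ring

lemma mgf_bound {n m : ℕ} (hm : 0 < m) (hmn : m ∣ n) (J : Finset (Fin m)) (Ω : Finset (Fin n))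
    (l : ℝ) (hl : 0 ≤ l) :
    ∑ π ∈ balA n m, Real.exp (l * (Ω.filter fun i => π i ∈ J).card)
      ≤ (1 + (J.card : ℝ) / m * (Real.exp l - 1)) ^ Ω.card * (balA n m).card := by
  have ha : 0 ≤ Real.exp l - 1 := by linarith [Real.add_one_le_exp l]
  set a := Real.exp l - 1 with hadef
  have h1 : ∀ π : Fin n → Fin m, Real.exp (l * (Ω.filter fun i => π i ∈ J).card)
      = ∑ S ∈ Ω.powerset, (if ∀ i ∈ S, π i ∈ J then a ^ S.card else 0) := by
    intro π
    have : Real.exp (l * (Ω.filter fun i => π i ∈ J).card)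
      = ∏ i ∈ Ω, (1 + if π i ∈ J then a else 0) := by
      rw [mul_comm, Real.exp_nat_mul, ← Finset.prod_const, Finset.prod_filter]
      apply Finset.prod_congr rfl
      intro i _
      split_ifs <;> simp [hadef]
    rw [this, Finset.prod_one_add]
    apply Finset.sum_congr rfl
    intro S _
    rw [Finset.prod_ite_zero]
    simp
  calc _ = ∑ S ∈ Ω.powerset, a ^ S.card * ((NN n m J S).card : ℝ) := by
        rw [Finset.sum_congr rfl (fun π _ => h1 π), Finset.sum_comm]
        apply Finset.sum_congr rfl
        intro S _
        rw [← Finset.sum_filter, Finset.sum_const, nsmul_eq_mul, mul_comm]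
        rfl
    _ ≤ ∑ S ∈ Ω.powerset, a ^ S.card * (((J.card : ℝ) / m) ^ S.card * (balA n m).card) := by
        gcongr with S _
        exact NN_bound hm hmn J S
    _ = (∑ S ∈ Ω.powerset, ∏ i ∈ S, ((J.card : ℝ) / m * a)) * (balA n m).card := by
        rw [Finset.sum_mul]
        apply Finset.sum_congr rfl
        intro S _
        rw [Finset.prod_const, mul_pow]; ring
    _ = _ := by
        rw [← Finset.prod_one_add, Finset.prod_const]

lemma markov {n m : ℕ} (J : Finset (Fin m)) (Ω : Finset (Fin n))
    (l : ℝ) (hl : 0 ≤ l) (x B : ℝ)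
    (h : ∑ π ∈ balA n m, Real.exp (l * (Ω.filter fun i => π i ∈ J).card) ≤ B) :
    (((balA n m).filter fun π => x ≤ (Ω.filter fun i => π i ∈ J).card).card : ℝ)
      ≤ Real.exp (-(l * x)) * B := by
  have : (((balA n m).filter fun π => x ≤ (Ω.filter fun i => π i ∈ J).card).card : ℝ)
      * Real.exp (l * x) ≤ B := by
    generalize hf : (fun π : Fin n → Fin m => ((Ω.filter fun i => π i ∈ J).card : ℝ)) = f at *
    have hf' : ∀ π : Fin n → Fin m, ((Ω.filter fun i => π i ∈ J).card : ℝ) = f π :=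
      fun π => congrFun hf π
    simp only [hf'] at h ⊢
    refine le_trans ?_ h
    calc (((balA n m).filter fun π => x ≤ f π).card : ℝ) * Real.exp (l * x)
        = ∑ π ∈ (balA n m).filter (fun π => x ≤ f π), Real.exp (l * x) := by
          rw [Finset.sum_const, nsmul_eq_mul]
      _ ≤ ∑ π ∈ (balA n m).filter (fun π => x ≤ f π), Real.exp (l * f π) := by
          apply Finset.sum_le_sum
          intro π hπ
          exact Real.exp_le_exp.2 (mul_le_mul_of_nonneg_left (Finset.mem_filter.1 hπ).2 hl)
      _ ≤ ∑ π ∈ balA n m, Real.exp (l * f π) :=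
          Finset.sum_le_sum_of_subset_of_nonneg (Finset.filter_subset _ _)
            (fun _ _ _ => (Real.exp_pos _).le)
  rw [Real.exp_neg, inv_mul_eq_div, le_div_iff₀ (Real.exp_pos _)]
  exact this

lemma pow_exp (x : ℝ) (hx : 0 ≤ 1 + x) (s : ℕ) : (1 + x) ^ s ≤ Real.exp (s * x) := by
  rw [Real.exp_nat_mul]
  gcongr
  linarith [Real.add_one_le_exp x]

lemma upper {n m : ℕ} (hm : 0 < m) (hmn : m ∣ n) (Ω : Finset (Fin n)) (j : Fin m)
    (t : ℝ) (ht0 : 0 < t) (ht1 : t < 1) :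
    (((balA n m).filter fun π =>
        (1 + t) * (Ω.card / m : ℝ) ≤ (Ω.filter fun i => π i = j).card).card : ℝ)
      ≤ Real.exp (-0.08 * t ^ 2 * Ω.card / m) * (balA n m).card := by
  have h := markov {j} Ω (t / 2) (by positivity) ((1 + t) * (Ω.card / m : ℝ)) _
    (mgf_bound hm hmn {j} Ω (t / 2) (by positivity))
  simp only [Finset.mem_singleton, Finset.card_singleton] at h
  refine h.trans ?_
  rw [← mul_assoc]
  gcongr
  have hmR : (0 : ℝ) < m := by exact_mod_cast hm
  have he := Real.abs_exp_sub_one_sub_id_le (x := t / 2) (by rw [abs_le]; constructor <;> linarith)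
  rw [abs_le] at he
  have he0 := Real.add_one_le_exp (t / 2)
  refine (mul_le_mul_of_nonneg_left (pow_exp _ ?_ _) (Real.exp_pos _).le).trans ?_
  · have : 0 ≤ ((1 : ℕ) : ℝ) / m * (Real.exp (t / 2) - 1) := mul_nonneg (by positivity) (by linarith)
    linarith
  · rw [← Real.exp_add]
    apply Real.exp_le_exp.2
    have hμ : 0 ≤ (Ω.card : ℝ) / m := by positivity
    have e1 : (Ω.card : ℝ) * (((1 : ℕ) : ℝ) / m * (Real.exp (t / 2) - 1))
      = (Ω.card : ℝ) / m * (Real.exp (t / 2) - 1) := by push_cast; ring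
    rw [e1, mul_div_assoc]
    have : (Ω.card : ℝ) / m * (Real.exp (t / 2) - 1) ≤ (Ω.card : ℝ) / m * (t / 2 + (t / 2) ^ 2) := by
      gcongr; linarith
    have h3 : 0 ≤ (Ω.card : ℝ) / m * t ^ 2 := by positivity
    nlinarith

lemma lower {n m : ℕ} (hm : 0 < m) (hmn : m ∣ n) (Ω : Finset (Fin n)) (j : Fin m)
    (t : ℝ) (ht0 : 0 < t) (ht1 : t < 1) :
    (((balA n m).filter fun π =>
        ((Ω.filter fun i => π i = j).card : ℝ) ≤ (1 - t) * (Ω.card / m : ℝ)).card : ℝ)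
      ≤ Real.exp (-0.08 * t ^ 2 * Ω.card / m) * (balA n m).card := by
  have h := markov {j}ᶜ Ω (t / 2) (by positivity) (Ω.card - (1 - t) * (Ω.card / m : ℝ)) _
    (mgf_bound hm hmn {j}ᶜ Ω (t / 2) (by positivity))
  have hmR : (0 : ℝ) < m := by exact_mod_cast hm
  have hcc : (({j}ᶜ : Finset (Fin m)).card : ℝ) = m - 1 := by
    rw [Finset.card_compl, Finset.card_singleton, Fintype.card_fin, Nat.cast_sub hm]; simp
  have hset : ((balA n m).filter fun π =>
        ((Ω.filter fun i => π i = j).card : ℝ) ≤ (1 - t) * (Ω.card / m : ℝ))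
      = (balA n m).filter fun π => Ω.card - (1 - t) * (Ω.card / m : ℝ) ≤
          (Ω.filter fun i => π i ∈ ({j}ᶜ : Finset (Fin m))).card := by
    apply Finset.filter_congr
    intro π _
    have h0 := Finset.card_filter_add_card_filter_not (s := Ω) (fun i => π i = j)
    have h1 : ((Ω.filter fun i => π i = j).card : ℝ)
      + (Ω.filter fun i => π i ∈ ({j}ᶜ : Finset (Fin m))).card = Ω.card := by
      simp only [Finset.mem_compl, Finset.mem_singleton]
      exact_mod_cast h0
    constructor <;> intro <;> linarith
  rw [hset]
  refine h.trans ?_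
  rw [← mul_assoc]
  gcongr
  rw [hcc]
  have he := Real.abs_exp_sub_one_sub_id_le (x := -(t / 2)) (by rw [abs_le]; constructor <;> linarith)
  rw [abs_le] at he
  have e0 : 1 + ((m : ℝ) - 1) / m * (Real.exp (t / 2) - 1)
      = Real.exp (t / 2) * (1 + (1 / m) * (Real.exp (-(t / 2)) - 1)) := by
    rw [Real.exp_neg]
    have := (Real.exp_pos (t / 2)).ne'
    field_simp
    ring
  rw [e0, mul_pow, ← Real.exp_nat_mul, ← mul_assoc, ← Real.exp_add]
  refine (mul_le_mul_of_nonneg_left (pow_exp _ ?_ _) (Real.exp_pos _).le).trans ?_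
  · have h1 : 1 / (m : ℝ) ≤ 1 := by
      rw [div_le_one hmR]; exact_mod_cast hm
    have h2 := Real.exp_pos (-(t / 2))
    have h3 : 0 ≤ 1 / (m : ℝ) := by positivity
    nlinarith
  · rw [← Real.exp_add]
    apply Real.exp_le_exp.2
    have hμ : 0 ≤ (Ω.card : ℝ) / m := by positivity
    have e1 : (Ω.card : ℝ) * (1 / m * (Real.exp (-(t / 2)) - 1))
      = (Ω.card : ℝ) / m * (Real.exp (-(t / 2)) - 1) := by ring
    rw [e1, mul_div_assoc]
    have : (Ω.card : ℝ) / m * (Real.exp (-(t / 2)) - 1) ≤ (Ω.card : ℝ) / m * (-(t / 2) + (t / 2) ^ 2) := by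
      gcongr; linarith
    have h3 : 0 ≤ (Ω.card : ℝ) / m * t ^ 2 := by positivity
    nlinarith

/-- Random grouping: the index set `{1,…,n}` is partitioned uniformly at random into
`m` groups of equal size `n/m` (encoded as a uniformly random labelling
`π : Fin n → Fin m` with all fibers of size `n/m`). If `t ∈ (0,1)` and
`s(1 + 0.1t) ≤ n`, the probability that `(1−t)·max_j |Ω_j| ≥ (1+t)·min_j |Ω_j|`
(with `Ω_j = Ω ∩ π⁻¹(j)` for a fixed set `Ω` of `s` true indices) is at most
`3·exp(−0.08 t² s/m + log m) + exp(−0.001 t² s)`. -/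
theorem stmt_16 (n m s : ℕ) (hm : 0 < m) (hmn : m ∣ n)
    (t : ℝ) (ht0 : 0 < t) (ht1 : t < 1)
    (Ω : Finset (Fin n)) (hΩ : Ω.card = s)
    (hs : (s : ℝ) * (1 + 0.1 * t) ≤ (n : ℝ)) :
    (((Finset.univ.filter fun π : Fin n → Fin m =>
          (∀ j : Fin m, (Finset.univ.filter fun i => π i = j).card = n / m) ∧
          (1 + t) * (Nat.cast (⨅ j : Fin m, (Ω.filter fun i => π i = j).card) : ℝ) ≤
            (1 - t) * (Nat.cast (⨆ j : Fin m, (Ω.filter fun i => π i = j).card) : ℝ)).card : ℝ) /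
        ((Finset.univ.filter fun π : Fin n → Fin m =>
          ∀ j : Fin m, (Finset.univ.filter fun i => π i = j).card = n / m).card : ℝ)) ≤
      3 * Real.exp (-0.08 * t ^ 2 * s / m + Real.log m) +
        Real.exp (-0.001 * t ^ 2 * s) := by
  subst hΩ
  have hmR : (0 : ℝ) < m := by exact_mod_cast hm
  haveI : Nonempty (Fin m) := ⟨⟨0, hm⟩⟩
  set E := Real.exp (-0.08 * t ^ 2 * Ω.card / m) with hE
  have hEpos : 0 < E := Real.exp_pos _
  rw [Real.exp_add, Real.exp_log hmR, ← hE]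
  refine div_le_of_le_mul₀ (by positivity) (by positivity) ?_
  change _ ≤ _ * ((balA n m).card : ℝ)
  have hsub : (Finset.univ.filter fun π : Fin n → Fin m =>
          (∀ j : Fin m, (Finset.univ.filter fun i => π i = j).card = n / m) ∧
          (1 + t) * (Nat.cast (⨅ j : Fin m, (Ω.filter fun i => π i = j).card) : ℝ) ≤
            (1 - t) * (Nat.cast (⨆ j : Fin m, (Ω.filter fun i => π i = j).card) : ℝ)) ⊆
      Finset.univ.biUnion (fun j : Fin m =>
        ((balA n m).filter fun π =>
          (1 + t) * (Ω.card / m : ℝ) ≤ (Ω.filter fun i => π i = j).card) ∪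
        ((balA n m).filter fun π =>
          ((Ω.filter fun i => π i = j).card : ℝ) ≤ (1 - t) * (Ω.card / m : ℝ))) := by
    intro π hπ
    rw [Finset.mem_filter] at hπ
    obtain ⟨-, hb, hπ⟩ := hπ
    have hb' : π ∈ balA n m := by simpa [balA] using hb
    obtain ⟨j1, h1⟩ := exists_eq_ciInf_of_finite (f := fun j : Fin m => (Ω.filter fun i => π i = j).card)
    obtain ⟨j2, h2⟩ := exists_eq_ciSup_of_finite (f := fun j : Fin m => (Ω.filter fun i => π i = j).card)
    rw [← h1, ← h2] at hπ
    simp only [Finset.mem_biUnion, Finset.mem_univ, true_and, Finset.mem_union, Finset.mem_filter, hb']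
    by_contra! hcon
    have c1 := (hcon j2).1
    have c2 := (hcon j1).2
    have d1 := mul_le_mul_of_nonneg_left c1.le (show 0 ≤ 1 - t by linarith)
    have d2 := mul_lt_mul_of_pos_left c2 (show 0 < 1 + t by linarith)
    nlinarith
  have hcard := (Finset.card_le_card hsub).trans Finset.card_biUnion_le
  have hcard' : ((Finset.univ.filter fun π : Fin n → Fin m =>
          (∀ j : Fin m, (Finset.univ.filter fun i => π i = j).card = n / m) ∧
          (1 + t) * (Nat.cast (⨅ j : Fin m, (Ω.filter fun i => π i = j).card) : ℝ) ≤
            (1 - t) * (Nat.cast (⨆ j : Fin m, (Ω.filter fun i => π i = j).card) : ℝ)).card : ℝ)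
      ≤ ∑ j : Fin m, (2 * E * (balA n m).card) := by
    refine (Nat.cast_le (α := ℝ).2 hcard).trans ?_
    rw [Nat.cast_sum]
    apply Finset.sum_le_sum
    intro j _
    refine (Nat.cast_le (α := ℝ).2 (Finset.card_union_le _ _)).trans ?_
    rw [Nat.cast_add]
    have hu := upper hm hmn Ω j t ht0 ht1
    have hl := lower hm hmn Ω j t ht0 ht1
    rw [← hE] at hu hl
    refine (add_le_add hu hl).trans (le_of_eq ?_)
    ring
  refine hcard'.trans ?_
  rw [Finset.sum_const, Finset.card_univ, Fintype.card_fin, nsmul_eq_mul]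
  have p1 : 0 ≤ E * m * (balA n m).card := by positivity
  have p2 : 0 ≤ Real.exp (-0.001 * t ^ 2 * Ω.card) * (balA n m).card := by positivity
  nlinarith
end

section
/- Let t ∈ (0,1), let m divide n with group size n/m, and assume s(1 + 0.1t) ≤ n. In the uniform random grouping model with a fixed set Ω of s true indices, the probability that max_{j∈{1,…,m}} |Ω_j| ≥ (s/m)(1 + t) is at most exp(−0.001 t² s) + exp(−0.08 t² s/m + log m). -/
open scoped Classical

noncomputable def balB (n m : ℕ) : Finset (Fin n → Fin m) :=
  Finset.univ.filter fun π : Fin n → Fin m =>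
    ∀ j : Fin m, (Finset.univ.filter fun i => π i = j).card = n / m

noncomputable def balN (n m : ℕ) (j : Fin m) (A : Finset (Fin n)) : Finset (Fin n → Fin m) :=
  (balB n m).filter fun π => ∀ i ∈ A, π i = j

lemma balN_swap (n m : ℕ) (j : Fin m) (A : Finset (Fin n)) (a b : Fin n) (ha : a ∉ A)
    (hb : b ∉ A) : (balN n m j (insert a A)).card ≤ (balN n m j (insert b A)).card := by
  apply Finset.card_le_card_of_injOn (fun π => π ∘ Equiv.swap a b)
  · intro π hπ
    simp only [balN, balB, Finset.coe_filter, Finset.mem_filter, Finset.mem_univ, true_and,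
      Set.mem_setOf_eq] at hπ ⊢
    refine ⟨fun l => ?_, ?_⟩
    · rw [← hπ.1 l]
      apply Finset.card_bij (fun i _ => Equiv.swap a b i)
      · intro i hi; simpa using hi
      · intro i _ i' _ h; simpa using h
      · intro i hi
        exact ⟨Equiv.swap a b i, by simpa using hi, by simp⟩
    · intro i hi
      rcases Finset.mem_insert.1 hi with rfl | hi
      · simpa using hπ.2 a (by simp)
      · have h1 : i ≠ a := fun h => ha (h ▸ hi)
        have h2 : i ≠ b := fun h => hb (h ▸ hi)
        simpa [Equiv.swap_apply_of_ne_of_ne h1 h2] using hπ.2 i (by simp [hi])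
  · intro π _ π' _ h
    funext i
    have := congrFun h (Equiv.swap a b i)
    simpa using this

lemma balN_sum (n m : ℕ) (j : Fin m) (A : Finset (Fin n)) :
    ∑ a ∈ Aᶜ, ((balN n m j (insert a A)).card : ℝ)
      = ((n / m : ℕ) - (A.card : ℝ)) * (balN n m j A).card := by
  have h1 : ∀ a, ((balN n m j (insert a A)).card : ℝ)
      = ∑ π ∈ balN n m j A, if π a = j then (1 : ℝ) else 0 := by
    intro a
    rw [Finset.sum_boole]
    congr 2
    ext π
    simp only [balN, Finset.mem_filter, Finset.mem_insert, forall_eq_or_imp]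
    tauto
  simp_rw [h1]
  rw [Finset.sum_comm, mul_comm, ← nsmul_eq_mul, ← Finset.sum_const]
  apply Finset.sum_congr rfl
  intro π hπ
  simp only [balN, balB, Finset.mem_filter, Finset.mem_univ, true_and] at hπ
  have h2 := Finset.sum_add_sum_compl A (fun a => if π a = j then (1 : ℝ) else 0)
  have h3 : ∑ a ∈ A, (if π a = j then (1 : ℝ) else 0) = A.card := by
    rw [Finset.sum_congr rfl (fun a ha => if_pos (hπ.2 a ha))]; simp
  have h4 : ∑ a, (if π a = j then (1 : ℝ) else 0) = (n / m : ℕ) := by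
    rw [Finset.sum_boole, ← hπ.1 j]
  linarith

lemma balN_step (n m : ℕ) (hm : 0 < m) (hmn : m ∣ n) (j : Fin m) (A : Finset (Fin n)) (a : Fin n)
    (ha : a ∉ A) : (m : ℝ) * (balN n m j (insert a A)).card ≤ (balN n m j A).card := by
  have h := balN_sum n m j A
  have hc : ∑ b ∈ Aᶜ, ((balN n m j (insert b A)).card : ℝ)
      = ((n : ℝ) - A.card) * (balN n m j (insert a A)).card := by
    rw [Finset.sum_congr rfl (g := fun _ => ((balN n m j (insert a A)).card : ℝ))]
    · rw [Finset.sum_const, nsmul_eq_mul, Finset.card_compl, Nat.cast_sub (Finset.card_le_univ A)]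
      simp
    · intro b hb
      rw [Finset.mem_compl] at hb
      exact_mod_cast le_antisymm (balN_swap n m j A b a hb ha) (balN_swap n m j A a b ha hb)
  rw [hc] at h
  have hk : (m : ℝ) * (n / m : ℕ) = n := by exact_mod_cast Nat.mul_div_cancel' hmn
  have hlt : (A.card : ℝ) < n := by
    have := Finset.card_lt_univ_of_notMem ha
    rw [Fintype.card_fin] at this
    exact_mod_cast this
  have hm1 : (1 : ℝ) ≤ m := by exact_mod_cast hm
  have hN : (0 : ℝ) ≤ (balN n m j A).card := by positivity
  have hA : (0 : ℝ) ≤ A.card := by positivity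
  refine le_of_mul_le_mul_left ?_ (sub_pos.2 hlt)
  calc ((n : ℝ) - A.card) * (m * (balN n m j (insert a A)).card)
      = m * (((n : ℝ) - A.card) * (balN n m j (insert a A)).card) := by ring
    _ = (m * (n / m : ℕ) - m * A.card) * (balN n m j A).card := by rw [h]; ring
    _ ≤ ((n : ℝ) - A.card) * (balN n m j A).card := by
      rw [hk]
      apply mul_le_mul_of_nonneg_right _ hN
      nlinarith

lemma balN_le (n m : ℕ) (hm : 0 < m) (hmn : m ∣ n) (j : Fin m) (A : Finset (Fin n)) :
    ((balN n m j A).card : ℝ) ≤ (balB n m).card * (1 / m : ℝ) ^ A.card := by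
  have hm0 : (0 : ℝ) < m := by exact_mod_cast hm
  induction A using Finset.induction_on with
  | empty => simp [balN]
  | insert a A ha ih =>
    rw [Finset.card_insert_of_notMem ha, pow_succ, ← mul_assoc]
    have := balN_step n m hm hmn j A a ha
    rw [mul_one_div, le_div_iff₀ hm0]
    linarith

lemma bal_mgf (n m : ℕ) (hm : 0 < m) (hmn : m ∣ n) (j : Fin m) (S : Finset (Fin n)) (x : ℝ)
    (hx : 0 ≤ x) :
    ∑ π ∈ balB n m, (1 + x) ^ (S.filter fun i => π i = j).card
      ≤ (balB n m).card * (1 + x / m) ^ S.card := by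
  have h1 : ∀ π : Fin n → Fin m, (1 + x) ^ (S.filter fun i => π i = j).card
      = ∑ A ∈ S.powerset, if ∀ i ∈ A, π i = j then x ^ A.card else 0 := by
    intro π
    rw [← Finset.prod_const, Finset.prod_filter]
    rw [Finset.prod_congr rfl (g := fun i => 1 + if π i = j then x else 0)
      (by intro i _; split_ifs <;> simp), Finset.prod_one_add]
    apply Finset.sum_congr rfl
    intro A _
    split_ifs with h
    · rw [Finset.prod_congr rfl (fun i hi => if_pos (h i hi)), Finset.prod_const]
    · push Not at h
      obtain ⟨i, hi, h⟩ := h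
      exact Finset.prod_eq_zero hi (if_neg h)
  simp_rw [h1]
  rw [Finset.sum_comm]
  have h2 : (1 + x / m) ^ S.card = ∑ A ∈ S.powerset, (x / m) ^ A.card := by
    rw [← Finset.prod_const, Finset.prod_one_add]
    simp [div_pow]
  rw [h2, Finset.mul_sum]
  apply Finset.sum_le_sum
  intro A _
  rw [← Finset.sum_filter, Finset.sum_const, nsmul_eq_mul]
  have := mul_le_mul_of_nonneg_right (balN_le n m hm hmn j A) (pow_nonneg hx A.card)
  refine this.trans (le_of_eq ?_)
  rw [mul_assoc, ← mul_pow, one_div_mul_eq_div]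

lemma markov_cnt {α : Type*} (B : Finset α) (P : α → Prop) (f : α → ℝ) (c : ℝ)
    (h : ∀ a, P a → c ≤ f a) (h0 : ∀ a, 0 ≤ f a) :
    ((B.filter P).card : ℝ) * c ≤ ∑ a ∈ B, f a := by
  rw [← nsmul_eq_mul, ← Finset.sum_const]
  exact (Finset.sum_le_sum fun a ha => h a (Finset.mem_filter.1 ha).2).trans
    (Finset.sum_le_sum_of_subset_of_nonneg (Finset.filter_subset _ _) fun a _ _ => h0 a)

lemma bal_tail (n m s : ℕ) (hm : 0 < m) (hmn : m ∣ n) (j : Fin m) (S : Finset (Fin n))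
    (hS : S.card = s) (t : ℝ) (ht0 : 0 < t) (ht1 : t < 1) :
    (((balB n m).filter fun π => ((s : ℝ) / m) * (1 + t) ≤
      ((S.filter fun i => π i = j).card : ℝ)).card : ℝ)
      ≤ (balB n m).card * Real.exp (-0.08 * t ^ 2 * s / m) := by
  have hm0 : (0 : ℝ) < m := by exact_mod_cast hm
  have hx : 0 ≤ Real.exp (t / 2) - 1 := by
    have := Real.add_one_le_exp (t / 2); linarith
  have h := bal_mgf n m hm hmn j S (Real.exp (t / 2) - 1) hx
  set p : ℝ := s / m with hp
  have hp0 : 0 ≤ p := by positivity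
  have h1 : (((balB n m).filter fun π => p * (1 + t) ≤
      ((S.filter fun i => π i = j).card : ℝ)).card : ℝ) * Real.exp (t / 2 * (p * (1 + t)))
      ≤ ∑ π ∈ balB n m, (1 + (Real.exp (t / 2) - 1)) ^ (S.filter fun i => π i = j).card := by
    apply markov_cnt
    · intro π hh
      rw [add_sub_cancel, ← Real.exp_nat_mul]
      apply Real.exp_le_exp.2
      rw [mul_comm _ (t / 2)]
      exact mul_le_mul_of_nonneg_left hh (by linarith)
    · intro π
      rw [add_sub_cancel]; positivity
  have h2 : (1 + (Real.exp (t / 2) - 1) / m) ^ S.card ≤ Real.exp (p * (t / 2 + (t / 2) ^ 2)) := by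
    have hq : Real.exp (t / 2) - 1 ≤ t / 2 + (t / 2) ^ 2 := by
      have := Real.abs_exp_sub_one_sub_id_le (x := t / 2) (by rw [abs_of_pos] <;> linarith)
      have := (abs_le.1 this).2
      linarith
    have ha : 1 + (Real.exp (t / 2) - 1) / m ≤ Real.exp ((t / 2 + (t / 2) ^ 2) / m) := by
      have h3 := Real.add_one_le_exp ((t / 2 + (t / 2) ^ 2) / m)
      have h4 : (Real.exp (t / 2) - 1) / m ≤ (t / 2 + (t / 2) ^ 2) / m := by gcongr
      linarith
    rw [hS]
    refine (pow_le_pow_left₀ (by positivity) ha s).trans (le_of_eq ?_)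
    rw [← Real.exp_nat_mul, hp]
    congr 1; ring
  have h3 := h1.trans (h.trans (mul_le_mul_of_nonneg_left h2 (Nat.cast_nonneg _)))
  rw [← le_div_iff₀ (Real.exp_pos _), mul_div_assoc, ← Real.exp_sub] at h3
  refine h3.trans (mul_le_mul_of_nonneg_left (Real.exp_le_exp.2 ?_) (Nat.cast_nonneg _))
  have : -0.08 * t ^ 2 * s / m = -0.08 * t ^ 2 * p := by rw [hp]; ring
  rw [this]
  nlinarith [mul_nonneg hp0 (sq_nonneg t)]


/-- Random grouping: the index set `{1,…,n}` is partitioned uniformly at random into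
`m` groups of equal size `n/m` (encoded as a uniformly random labelling
`π : Fin n → Fin m` with all fibers of size `n/m`). If `t ∈ (0,1)` and
`s(1 + 0.1t) ≤ n`, the probability that `max_j |Ω_j| ≥ (s/m)(1 + t)`
(with `Ω_j = Ω ∩ π⁻¹(j)` for a fixed set `Ω` of `s` true indices) is at most
`exp(−0.001 t² s) + exp(−0.08 t² s/m + log m)`. -/
theorem stmt_17 (n m s : ℕ) (hm : 0 < m) (hmn : m ∣ n)
    (t : ℝ) (ht0 : 0 < t) (ht1 : t < 1)
    (Ω : Finset (Fin n)) (hΩ : Ω.card = s)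
    (hs : (s : ℝ) * (1 + 0.1 * t) ≤ (n : ℝ)) :
    (((Finset.univ.filter fun π : Fin n → Fin m =>
          (∀ j : Fin m, (Finset.univ.filter fun i => π i = j).card = n / m) ∧
          ((s : ℝ) / (m : ℝ)) * (1 + t) ≤
            (Nat.cast (⨆ j : Fin m, (Ω.filter fun i => π i = j).card) : ℝ)).card : ℝ) /
        ((Finset.univ.filter fun π : Fin n → Fin m =>
          ∀ j : Fin m, (Finset.univ.filter fun i => π i = j).card = n / m).card : ℝ)) ≤
      Real.exp (-0.001 * t ^ 2 * s) +
        Real.exp (-0.08 * t ^ 2 * s / m + Real.log m) := by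
  have hm0 : (0 : ℝ) < m := by exact_mod_cast hm
  haveI : Nonempty (Fin m) := ⟨⟨0, hm⟩⟩
  have hsub : (Finset.univ.filter fun π : Fin n → Fin m =>
          (∀ j : Fin m, (Finset.univ.filter fun i => π i = j).card = n / m) ∧
          ((s : ℝ) / (m : ℝ)) * (1 + t) ≤
            (Nat.cast (⨆ j : Fin m, (Ω.filter fun i => π i = j).card) : ℝ)) ⊆
      Finset.univ.biUnion fun j => (balB n m).filter fun π => ((s : ℝ) / m) * (1 + t) ≤
      ((Ω.filter fun i => π i = j).card : ℝ) := by
    intro π hπ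
    simp only [Finset.mem_filter, Finset.mem_univ, true_and] at hπ
    obtain ⟨j, hj⟩ := exists_eq_ciSup_of_finite (f := fun j : Fin m => (Ω.filter fun i => π i = j).card)
    simp only [Finset.mem_biUnion, Finset.mem_univ, true_and, Finset.mem_filter, balB]
    refine ⟨j, hπ.1, ?_⟩
    have h2 := hπ.2
    rw [← hj] at h2
    exact h2
  have hcard := (Finset.card_le_card hsub).trans Finset.card_biUnion_le
  have hR := (Nat.cast_le (α := ℝ)).2 hcard
  rw [Nat.cast_sum] at hR
  have hR2 := hR.trans (Finset.sum_le_sum fun j _ => bal_tail n m s hm hmn j Ω hΩ t ht0 ht1)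
  rw [Finset.sum_const, Finset.card_univ, Fintype.card_fin, nsmul_eq_mul] at hR2
  have hpos := Real.exp_pos (-0.001 * t ^ 2 * s)
  refine le_trans ?_ (le_add_of_nonneg_left hpos.le)
  refine div_le_of_le_mul₀ (Nat.cast_nonneg _) (Real.exp_pos _).le (hR2.trans (le_of_eq ?_))
  rw [Real.exp_add, Real.exp_log hm0]
  unfold balB
  ring
end

section
/- Let t ∈ (0,1) and let m divide n with group size n/m. In the uniform random grouping model with a fixed set Ω of s true indices, the probability that min_{j∈{1,…,m}} |Ω_j| ≤ (s/m)(1 − t) is at most 2·exp(−0.08 t² s/m + log m). -/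
open scoped Classical

def balSet (n m : ℕ) : Finset (Fin n → Fin m) :=
  Finset.univ.filter fun π : Fin n → Fin m =>
          ∀ j : Fin m, (Finset.univ.filter fun i => π i = j).card = n / m

def avoidSet (n m : ℕ) (j : Fin m) (T : Finset (Fin n)) : Finset (Fin n → Fin m) :=
  (balSet n m).filter fun π => ∀ i ∈ T, π i ≠ j

lemma bal_swap {n m : ℕ} (π : Fin n → Fin m) (σ : Equiv.Perm (Fin n)) (h : π ∈ balSet n m) :
    π ∘ σ ∈ balSet n m := by
  simp only [balSet, Finset.mem_filter, Finset.mem_univ, true_and] at h ⊢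
  intro j
  rw [← h j]
  refine Finset.card_bij (fun i _ => σ i) ?_ ?_ ?_
  · intro a ha
    simpa using ha
  · intro a _ b _ hab
    exact σ.injective hab
  · intro b hb
    refine ⟨σ.symm b, ?_, by simp⟩
    simpa using hb

lemma hit_le {n m : ℕ} (j : Fin m) (T : Finset (Fin n)) (a b : Fin n) (ha : a ∉ T) (hb : b ∉ T) :
    ((avoidSet n m j T).filter fun π => π a = j).card ≤
    ((avoidSet n m j T).filter fun π => π b = j).card := by
  refine Finset.card_le_card_of_injOn (fun π => π ∘ Equiv.swap a b) ?_ ?_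
  · intro π hπ
    simp only [avoidSet, Finset.coe_filter, Finset.mem_filter, Set.mem_setOf_eq] at hπ ⊢
    refine ⟨⟨bal_swap _ _ hπ.1.1, ?_⟩, ?_⟩
    · intro i hi
      have h1 : i ≠ a := fun h => ha (h ▸ hi)
      have h2 : i ≠ b := fun h => hb (h ▸ hi)
      simpa [Equiv.swap_apply_of_ne_of_ne h1 h2] using hπ.1.2 i hi
    · simpa using hπ.2
  · intro π _ π' _ h
    funext i
    have := congrFun h (Equiv.swap a b i)
    simpa using this

lemma hit_count {n m : ℕ} (j : Fin m) (T : Finset (Fin n)) (a : Fin n) (ha : a ∉ T) :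
    (avoidSet n m j T).card * (n / m) ≤
      n * ((avoidSet n m j T).filter fun π => π a = j).card := by
  have h1 : ∑ π ∈ avoidSet n m j T, (Finset.univ.filter fun i => π i = j).card
      = (avoidSet n m j T).card * (n / m) := by
    rw [Finset.sum_const_nat]
    intro π hπ
    simp only [avoidSet, balSet, Finset.mem_filter, Finset.mem_univ, true_and] at hπ
    exact hπ.1 j
  have h2 : ∑ π ∈ avoidSet n m j T, (Finset.univ.filter fun i => π i = j).card
      = ∑ i : Fin n, ((avoidSet n m j T).filter fun π => π i = j).card := by
    simp only [Finset.card_filter]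
    rw [Finset.sum_comm]
  rw [← h1, h2]
  calc _ ≤ ∑ i : Fin n, ((avoidSet n m j T).filter fun π => π a = j).card := by
        apply Finset.sum_le_sum
        intro i _
        by_cases hi : i ∈ T
        · have : ((avoidSet n m j T).filter fun π => π i = j) = ∅ := by
            apply Finset.filter_eq_empty_iff.2
            intro π hπ
            exact (Finset.mem_filter.1 hπ).2 i hi
          rw [this]; simp
        · exact hit_le j T i a hi ha
    _ = _ := by simp

lemma avoid_le {n m : ℕ} (hm : 0 < m) (hmn : m ∣ n) (j : Fin m) (T : Finset (Fin n)) :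
    ((avoidSet n m j T).card : ℝ) ≤ (1 - 1 / (m : ℝ)) ^ T.card * ((balSet n m).card : ℝ) := by
  have hmR : (1 : ℝ) ≤ m := by exact_mod_cast hm
  have hp : (0 : ℝ) ≤ 1 - 1 / (m : ℝ) := by
    have : 1 / (m : ℝ) ≤ 1 := by rw [div_le_one (by linarith)]; exact hmR
    linarith
  induction T using Finset.induction_on with
  | empty => simp [avoidSet]
  | insert a T ha ih =>
    have hn : 0 < n := Fin.pos a
    have hsplit : (avoidSet n m j (insert a T)).card +
        ((avoidSet n m j T).filter fun π => π a = j).card = (avoidSet n m j T).card := by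
      rw [← Finset.card_filter_add_card_filter_not (s := avoidSet n m j T) (fun π => π a = j),
        add_comm]
      congr 2
      ext π
      simp only [avoidSet, Finset.mem_filter, Finset.mem_insert, forall_eq_or_imp]
      tauto
    have hc := hit_count j T a ha
    have hc' : ((avoidSet n m j T).card : ℝ) * ((n : ℝ) / m) ≤
        n * (((avoidSet n m j T).filter fun π => π a = j).card : ℝ) := by
      rw [← Nat.cast_div hmn (by positivity)]
      exact_mod_cast hc
    have hs' : ((avoidSet n m j (insert a T)).card : ℝ) +
        (((avoidSet n m j T).filter fun π => π a = j).card : ℝ) = (avoidSet n m j T).card := by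
      exact_mod_cast hsplit
    have hnR : (0 : ℝ) < n := by exact_mod_cast hn
    have hk : ((avoidSet n m j T).card : ℝ) * (1 / m) ≤
        (((avoidSet n m j T).filter fun π => π a = j).card : ℝ) := by
      refine le_of_mul_le_mul_left ?_ hnR
      calc _ = ((avoidSet n m j T).card : ℝ) * ((n : ℝ) / m) := by ring
        _ ≤ _ := hc'
    rw [Finset.card_insert_of_notMem ha, pow_succ]
    have := mul_le_mul_of_nonneg_left ih hp
    nlinarith

lemma mgf_le {n m : ℕ} (hm : 0 < m) (hmn : m ∣ n) (j : Fin m) (Ω : Finset (Fin n))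
    (y : ℝ) (hy0 : 0 ≤ y) (hy1 : y ≤ 1) :
    ∑ π ∈ balSet n m, y ^ (Ω.filter fun i => π i = j).card ≤
      (1 - (1 - y) / m) ^ Ω.card * ((balSet n m).card : ℝ) := by
  have h1 : ∀ π : Fin n → Fin m, y ^ (Ω.filter fun i => π i = j).card =
      ∑ T ∈ Ω.powerset, (1 - y) ^ T.card * y ^ (Ω.card - T.card) *
        (if ∀ i ∈ T, π i ≠ j then 1 else 0) := by
    intro π
    have : y ^ (Ω.filter fun i => π i = j).card =
        ∏ i ∈ Ω, ((if π i ≠ j then (1 - y) else 0) + y) := by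
      rw [← Finset.prod_const, Finset.prod_filter]
      apply Finset.prod_congr rfl
      intro i _
      by_cases h : π i = j <;> simp [h]
    rw [this, Finset.prod_add]
    apply Finset.sum_congr rfl
    intro T hT
    rw [Finset.prod_const, Finset.card_sdiff_of_subset (Finset.mem_powerset.1 hT)]
    rw [Finset.prod_ite_zero, Finset.prod_const]
    split_ifs <;> simp
  simp_rw [h1]
  rw [Finset.sum_comm]
  have h2 : (1 - (1 - y) / m) ^ Ω.card * ((balSet n m).card : ℝ) =
      ∑ T ∈ Ω.powerset, (((1 - y) * (1 - 1 / (m:ℝ))) ^ T.card * y ^ (Ω.card - T.card)) *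
        ((balSet n m).card : ℝ) := by
    rw [← Finset.sum_mul, Finset.sum_pow_mul_eq_add_pow]
    congr 2
    ring
  rw [h2]
  apply Finset.sum_le_sum
  intro T _
  rw [← Finset.mul_sum, Finset.sum_boole]
  have h3 := avoid_le hm hmn j T
  have h4 : (0 : ℝ) ≤ (1 - y) ^ T.card * y ^ (Ω.card - T.card) := by
    have : 0 ≤ 1 - y := by linarith
    positivity
  calc _ ≤ (1 - y) ^ T.card * y ^ (Ω.card - T.card) *
        ((1 - 1 / (m : ℝ)) ^ T.card * ((balSet n m).card : ℝ)) :=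
        mul_le_mul_of_nonneg_left h3 h4
    _ = _ := by rw [mul_pow]; ring

lemma exp_neg_quad {t : ℝ} (ht : 0 ≤ t) : Real.exp (-t) ≤ 1 - t + t ^ 2 / 2 := by
  have h := Real.quadratic_le_exp_of_nonneg ht
  rw [Real.exp_neg, inv_le_iff_one_le_mul₀ (Real.exp_pos t)]
  have h0 : 0 ≤ 1 - t + t ^ 2 / 2 := by nlinarith [sq_nonneg (t - 1)]
  calc (1 : ℝ) ≤ (1 - t + t ^ 2 / 2) * (1 + t + t ^ 2 / 2) := by nlinarith [sq_nonneg (t ^ 2)]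
    _ ≤ _ := mul_le_mul_of_nonneg_left h h0

lemma tail_le {n m : ℕ} (hm : 0 < m) (hmn : m ∣ n) (j : Fin m) (Ω : Finset (Fin n))
    (t : ℝ) (ht0 : 0 < t) :
    (((balSet n m).filter fun π => ((Ω.filter fun i => π i = j).card : ℝ) ≤
      ((Ω.card : ℝ) / m) * (1 - t)).card : ℝ) ≤
      Real.exp (-(t ^ 2 / 2 * (Ω.card / m))) * ((balSet n m).card : ℝ) := by
  set μ : ℝ := (Ω.card : ℝ) / m with hμ
  have hμ0 : 0 ≤ μ := by positivity
  have hmR : (1 : ℝ) ≤ m := by exact_mod_cast hm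
  have hy1 : Real.exp (-t) ≤ 1 := Real.exp_le_one_iff.2 (by linarith)
  have hM := mgf_le hm hmn j Ω (Real.exp (-t)) (Real.exp_pos _).le hy1
  have hlow : (((balSet n m).filter fun π => ((Ω.filter fun i => π i = j).card : ℝ) ≤
      μ * (1 - t)).card : ℝ) * Real.exp (-t * (μ * (1 - t))) ≤
      ∑ π ∈ balSet n m, Real.exp (-t) ^ (Ω.filter fun i => π i = j).card := by
    rw [← nsmul_eq_mul, ← Finset.sum_const]
    refine le_trans (Finset.sum_le_sum (fun π hπ => ?_))
      (Finset.sum_le_sum_of_subset_of_nonneg (Finset.filter_subset _ _) (fun _ _ _ => by positivity))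
    have hx := (Finset.mem_filter.1 hπ).2
    rw [← Real.exp_nat_mul]
    apply Real.exp_le_exp.2
    nlinarith
  have hbase : (1 - (1 - Real.exp (-t)) / m) ^ Ω.card ≤
      Real.exp (-(μ * (t - t ^ 2 / 2))) := by
    have h0 : 0 ≤ 1 - (1 - Real.exp (-t)) / m := by
      have : (1 - Real.exp (-t)) / m ≤ 1 := by
        rw [div_le_one (by linarith)]
        linarith [Real.exp_pos (-t)]
      linarith
    have h1 : 1 - (1 - Real.exp (-t)) / m ≤ Real.exp (-((1 - Real.exp (-t)) / m)) := by
      linarith [Real.add_one_le_exp (-((1 - Real.exp (-t)) / m))]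
    refine le_trans (pow_le_pow_left₀ h0 h1 _) ?_
    rw [← Real.exp_nat_mul]
    apply Real.exp_le_exp.2
    have h2 := exp_neg_quad ht0.le
    have : (Ω.card : ℝ) * (-((1 - Real.exp (-t)) / m)) = -(μ * (1 - Real.exp (-t))) := by
      rw [hμ]; ring
    rw [this]
    nlinarith
  have hN : (0 : ℝ) ≤ (balSet n m).card := by positivity
  have h5 := (hlow.trans hM).trans (mul_le_mul_of_nonneg_right hbase hN)
  refine le_of_mul_le_mul_right (h5.trans (le_of_eq ?_)) (Real.exp_pos (-t * (μ * (1 - t))))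
  rw [mul_right_comm, ← Real.exp_add]
  congr 2
  ring

/-- Random grouping: the index set `{1,…,n}` is partitioned uniformly at random into
`m` groups of equal size `n/m` (encoded as a uniformly random labelling
`π : Fin n → Fin m` with all fibers of size `n/m`). For `t ∈ (0,1)`, the probability
that `min_j |Ω_j| ≤ (s/m)(1 − t)` (with `Ω_j = Ω ∩ π⁻¹(j)` for a fixed set `Ω` of
`s` true indices) is at most `2·exp(−0.08 t² s/m + log m)`. -/
theorem stmt_18 (n m s : ℕ) (hm : 0 < m) (hmn : m ∣ n)
    (t : ℝ) (ht0 : 0 < t) (ht1 : t < 1)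
    (Ω : Finset (Fin n)) (hΩ : Ω.card = s) :
    (((Finset.univ.filter fun π : Fin n → Fin m =>
          (∀ j : Fin m, (Finset.univ.filter fun i => π i = j).card = n / m) ∧
          (Nat.cast (⨅ j : Fin m, (Ω.filter fun i => π i = j).card) : ℝ) ≤
            ((s : ℝ) / (m : ℝ)) * (1 - t)).card : ℝ) /
        ((Finset.univ.filter fun π : Fin n → Fin m =>
          ∀ j : Fin m, (Finset.univ.filter fun i => π i = j).card = n / m).card : ℝ)) ≤
      2 * Real.exp (-0.08 * t ^ 2 * s / m + Real.log m) := by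
  subst hΩ
  have hmR : (0 : ℝ) < m := by exact_mod_cast hm
  haveI : Nonempty (Fin m) := ⟨⟨0, hm⟩⟩
  rw [Real.exp_add, Real.exp_log hmR]
  apply div_le_of_le_mul₀ (by positivity) (by positivity)
  change _ ≤ _ * ((balSet n m).card : ℝ)
  have hN : (0 : ℝ) ≤ (balSet n m).card := by positivity
  have hsub : (Finset.univ.filter fun π : Fin n → Fin m =>
          (∀ j : Fin m, (Finset.univ.filter fun i => π i = j).card = n / m) ∧
          (Nat.cast (⨅ j : Fin m, (Ω.filter fun i => π i = j).card) : ℝ) ≤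
            ((Ω.card : ℝ) / (m : ℝ)) * (1 - t)) ⊆
      Finset.univ.biUnion (fun j : Fin m =>
        (balSet n m).filter fun π => ((Ω.filter fun i => π i = j).card : ℝ) ≤
          ((Ω.card : ℝ) / m) * (1 - t)) := by
    intro π hπ
    simp only [Finset.mem_filter, Finset.mem_univ, true_and] at hπ
    obtain ⟨j, hj⟩ := ciInf_mem (fun j : Fin m => (Ω.filter fun i => π i = j).card)
    simp only [Finset.mem_biUnion, Finset.mem_filter, Finset.mem_univ, true_and, balSet]
    refine ⟨j, hπ.1, ?_⟩
    have h := hπ.2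
    rw [← hj] at h
    exact h
  have h1 := (Finset.card_le_card hsub).trans Finset.card_biUnion_le
  have h2 : (((Finset.univ.filter fun π : Fin n → Fin m =>
          (∀ j : Fin m, (Finset.univ.filter fun i => π i = j).card = n / m) ∧
          (Nat.cast (⨅ j : Fin m, (Ω.filter fun i => π i = j).card) : ℝ) ≤
            ((Ω.card : ℝ) / (m : ℝ)) * (1 - t)).card : ℕ) : ℝ) ≤
      ∑ j : Fin m, (((balSet n m).filter fun π => ((Ω.filter fun i => π i = j).card : ℝ) ≤
          ((Ω.card : ℝ) / m) * (1 - t)).card : ℝ) := by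
    exact_mod_cast h1
  refine h2.trans ((Finset.sum_le_sum fun j _ => tail_le hm hmn j Ω t ht0).trans ?_)
  rw [Finset.sum_const, Finset.card_univ, Fintype.card_fin, nsmul_eq_mul]
  have h3 : Real.exp (-(t ^ 2 / 2 * (Ω.card / m))) ≤
      Real.exp (-0.08 * t ^ 2 * Ω.card / m) := by
    apply Real.exp_le_exp.2
    have : (0 : ℝ) ≤ t ^ 2 * (Ω.card / m) := by positivity
    have e : -0.08 * t ^ 2 * (Ω.card : ℝ) / m = -0.08 * (t ^ 2 * (Ω.card / m)) := by ring
    rw [e]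
    nlinarith
  have h4 : (m : ℝ) * (Real.exp (-(t ^ 2 / 2 * (Ω.card / m))) * ((balSet n m).card : ℝ)) ≤
      m * (Real.exp (-0.08 * t ^ 2 * Ω.card / m) * ((balSet n m).card : ℝ)) := by gcongr
  have h5 : (0 : ℝ) ≤ m * (Real.exp (-0.08 * t ^ 2 * Ω.card / m) * ((balSet n m).card : ℝ)) := by
    positivity
  nlinarith
end
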